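/- arXiv:2012.01685 — 2 statements merged into one kernel-verified Lean document; each statement's English description precedes it below -/
import Mathlib

section
/- Let E be a finite-dimensional real inner product space, let R : E → ℝ (the empirical training risk) and ℓ : E → ℝ (the training loss of a sample z) be differentiable, and let θ : ℝ → E be differentiable at 0 with θ(0) = θ̂. Assume: (i) the gradient map ∇R : E → E is differentiable at θ̂ with Fréchet derivative the continuous linear map H : E → E (the Hessian of R at θ̂); (ii) H is invertible; (iii) the gradient map ∇ℓ : E → E is continuous at θ̂; and (iv) there is a neighborhood U of 0 in ℝ such that for all ε ∈ U the stationarity condition ∇R(θ(ε)) + ε·∇ℓ(θ(ε)) = 0 holds. Then θ'(0) = −H⁻¹(∇ℓ(θ̂)). -/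
open scoped RealInnerProductSpace

/-- The map `t ↦ t • g t` has derivative `g 0` at `0` as soon as `g` is continuous at `0`. -/
theorem ContinuousAt.hasDerivAt_id_smul_zero {𝕜 F : Type*} [NontriviallyNormedField 𝕜]
    [NormedAddCommGroup F] [NormedSpace 𝕜 F] {g : 𝕜 → F} (hg : ContinuousAt g 0) :
    HasDerivAt (fun t : 𝕜 => t • g t) (g 0) 0 := by
  rw [hasDerivAt_iff_tendsto_slope]
  refine (hg.tendsto.mono_left nhdsWithin_le_nhds).congr' ?_
  filter_upwards [self_mem_nhdsWithin] with t ht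
  have ht0 : t ≠ 0 := ht
  simp [slope_def_module, smul_smul, ht0]

/-- Equation (2): the influence of upweighting a training sample `z` on the parameters,
`dθ̂_{ε,z}/dε |_{ε=0} = −H⁻¹ ∇ℓ(θ̂)`, derived from the stationarity condition
`∇R(θ(ε)) + ε ∇ℓ(θ(ε)) = 0` near `ε = 0`. -/
theorem influence_on_params
    {E : Type*} [NormedAddCommGroup E] [InnerProductSpace ℝ E] [FiniteDimensional ℝ E]
    (θhat : E) (R ℓ : E → ℝ) (θ : ℝ → E) (H : E ≃L[ℝ] E)
    (hR : Differentiable ℝ R) (hℓ : Differentiable ℝ ℓ)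
    (hθ : DifferentiableAt ℝ θ 0) (hθ0 : θ 0 = θhat)
    (hH : HasFDerivAt (gradient R) (H : E →L[ℝ] E) θhat)
    (hgradcont : ContinuousAt (gradient ℓ) θhat)
    (hstat : ∀ᶠ ε in nhds (0 : ℝ), gradient R (θ ε) + ε • gradient ℓ (θ ε) = 0) :
    deriv θ 0 = -(H.symm (gradient ℓ θhat)) := by
  subst hθ0
  have hR_deriv : HasDerivAt (fun ε => gradient R (θ ε)) (H (deriv θ 0)) 0 :=
    hH.comp_hasDerivAt (0 : ℝ) hθ.hasDerivAt
  have hℓ_deriv : HasDerivAt (fun ε : ℝ => ε • gradient ℓ (θ ε)) (gradient ℓ (θ 0)) 0 :=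
    (ContinuousAt.comp (f := θ) hgradcont hθ.continuousAt).hasDerivAt_id_smul_zero
  have hsum : H (deriv θ 0) + gradient ℓ (θ 0) = 0 :=
    (hR_deriv.add hℓ_deriv).unique
      ((hasDerivAt_const (0 : ℝ) (0 : E)).congr_of_eventuallyEq hstat)
  rw [← map_neg, ← eq_neg_of_add_eq_zero_left hsum, H.symm_apply_apply]
end

section
/- (Cross-loss influence, Theorem 1.) Let E be a finite-dimensional real inner product space, let R : E → ℝ (the empirical training risk) and ℓ : E → ℝ (the training loss of a sample z) be differentiable, and let θ : ℝ → E be differentiable at 0 with θ(0) = θ̂. Assume: (i) the gradient map ∇R : E → E is differentiable at θ̂ with Fréchet derivative the invertible continuous linear map H : E → E (the Hessian of R at θ̂); (ii) the gradient map ∇ℓ : E → E is continuous at θ̂; (iii) for all ε in some neighborhood of 0, ∇R(θ(ε)) + ε·∇ℓ(θ(ε)) = 0. Let L' : E → ℝ be any function (a test loss, possibly different from the training loss) that is differentiable at θ̂. Then ε ↦ L'(θ(ε)) is differentiable at 0 and d/dε L'(θ(ε)) |_{ε=0} = −⟨∇L'(θ̂), H⁻¹(∇ℓ(θ̂))⟩.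 -/
open scoped RealInnerProductSpace

/-- If `g` is continuous at `0`, then `ε ↦ ε • g ε` has derivative `g 0` at `0`, even when `g` is
not differentiable there. -/
theorem hasDerivAt_id_smul_of_continuousAt {F : Type*} [NormedAddCommGroup F] [NormedSpace ℝ F]
    {g : ℝ → F} (hg : ContinuousAt g 0) : HasDerivAt (fun ε => ε • g ε) (g 0) 0 := by
  rw [hasDerivAt_iff_tendsto_slope]
  refine (hg.tendsto.mono_left nhdsWithin_le_nhds).congr' ?_
  filter_upwards [self_mem_nhdsWithin] with ε hε
  have hε0 : ε ≠ 0 := hε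
  simp [slope, hε0]

/-- A curve of zeros of `gR + ε • gℓ`, differentiable at `0`, has derivative `-H⁻¹ (gℓ (θ 0))` there,
where `H` is the invertible derivative of `gR` at `θ 0`. -/
theorem hasDerivAt_of_stationary_curve
    {E : Type*} [NormedAddCommGroup E] [NormedSpace ℝ E]
    {gR gℓ : E → E} {θ : ℝ → E} {H : E ≃L[ℝ] E} (hθ : DifferentiableAt ℝ θ 0)
    (hH : HasFDerivAt gR (H : E →L[ℝ] E) (θ 0)) (hgℓ : ContinuousAt gℓ (θ 0))
    (hstat : ∀ᶠ ε in nhds (0 : ℝ), gR (θ ε) + ε • gℓ (θ ε) = 0) :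
    HasDerivAt θ (-H.symm (gℓ (θ 0))) 0 := by
  have hsum : HasDerivAt (fun ε => gR (θ ε) + ε • gℓ (θ ε)) (H (deriv θ 0) + gℓ (θ 0)) 0 :=
    (hH.comp_hasDerivAt 0 hθ.hasDerivAt).add
      (hasDerivAt_id_smul_of_continuousAt (g := fun ε => gℓ (θ ε))
        (hgℓ.comp hθ.continuousAt))
  have hzero : H (deriv θ 0) + gℓ (θ 0) = 0 :=
    hsum.unique ((hasDerivAt_const (0 : ℝ) (0 : E)).congr_of_eventuallyEq hstat)
  have hderiv : deriv θ 0 = -H.symm (gℓ (θ 0)) := by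
    rw [← map_neg, ← eq_neg_of_add_eq_zero_left hzero, H.symm_apply_apply]
  exact hderiv ▸ hθ.hasDerivAt

/-- Theorem 1 (cross-loss influence): the influence of upweighting training sample `z`
on an arbitrary differentiable test objective `L'` is
`d/dε L'(θ(ε)) |_{ε=0} = −⟨∇L'(θ̂), H⁻¹ ∇ℓ(θ̂)⟩`;
the training and testing loss functions need not coincide. -/
theorem cross_loss_influence
    {E : Type*} [NormedAddCommGroup E] [InnerProductSpace ℝ E] [FiniteDimensional ℝ E]
    (θhat : E) (R ℓ : E → ℝ) (θ : ℝ → E) (H : E ≃L[ℝ] E)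
    (hR : Differentiable ℝ R) (hℓ : Differentiable ℝ ℓ)
    (hθ : DifferentiableAt ℝ θ 0) (hθ0 : θ 0 = θhat)
    (hH : HasFDerivAt (gradient R) (H : E →L[ℝ] E) θhat)
    (hgradcont : ContinuousAt (gradient ℓ) θhat)
    (hstat : ∀ᶠ ε in nhds (0 : ℝ), gradient R (θ ε) + ε • gradient ℓ (θ ε) = 0)
    (L' : E → ℝ) (hL' : DifferentiableAt ℝ L' θhat) :
    HasDerivAt (fun ε => L' (θ ε))
      (-⟪gradient L' θhat, H.symm (gradient ℓ θhat)⟫) 0 := by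
  subst hθ0
  have h := hL'.hasGradientAt.hasFDerivAt.comp_hasDerivAt 0
    (hasDerivAt_of_stationary_curve hθ hH hgradcont hstat)
  simpa [Function.comp_def] using h
end
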